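/- Let N, M, Z be positive integers, let s : [1..N] × [1..M] → ℝ give scenario realizations, and let Π₁,…,Π_Z be pairwise disjoint subsets of [1..M] (a partition of the scenario set into Z parts). For each z ∈ [1..Z], let α ∈ (0,1], let G_z ⊆ Π_z with |G_z| = ⌈α|Π_z|⌉, and define the partition summary S^z by S^z_i := min_{j ∈ G_z} s_{ij}. Let x₁,…,x_N ≥ 0, v ∈ ℝ, and let W ⊆ [1..Z] be the set of summaries satisfied by x, i.e., W = { z : ∑_{i=1}^N S^z_i x_i ≥ v }. Then the number of scenarios j ∈ [1..M] with ∑_{i=1}^N s_{ij} x_i ≥ v is at least ∑_{z ∈ W} ⌈α|Π_z|⌉; in particular, if |W| ≥ ⌈pZ⌉ for some p ∈ [0,1], then x satisfies at least ⌈pZ⌉ · min_z ⌈α|Π_z|⌉ of the M scenarios. -/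

import Mathlib

/-- With `Z` disjoint partitions of the scenario set, each summarized by a
tuple-wise minimum over a subset of size `⌈α |Π_z|⌉`, the number of scenarios
satisfied by a nonnegative solution `x` is at least the sum of `⌈α |Π_z|⌉`
over the summaries `z` that `x` satisfies; in particular, if `x` satisfies at
least `⌈p Z⌉` summaries, it satisfies at least `⌈p Z⌉ · min_z ⌈α |Π_z|⌉`
scenarios. -/
theorem csa_partition_summaries_guarantee
    (N M Z : ℕ) (hN : 0 < N) (hM : 0 < M) (hZ : 0 < Z)
    (s : Fin N → Fin M → ℝ)
    (P : Fin Z → Finset (Fin M))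
    (hdisj : ∀ z₁ z₂ : Fin Z, z₁ ≠ z₂ → Disjoint (P z₁) (P z₂))
    (α : ℝ) (hα0 : 0 < α) (hα1 : α ≤ 1)
    (G : Fin Z → Finset (Fin M))
    (hGsub : ∀ z, G z ⊆ P z)
    (hGcard : ∀ z, (G z).card = ⌈α * ((P z).card : ℝ)⌉₊)
    (hGne : ∀ z, (G z).Nonempty)
    (S : Fin Z → Fin N → ℝ)
    (hS : ∀ z i, S z i = (G z).inf' (hGne z) (fun j => s i j))
    (x : Fin N → ℝ) (hx : ∀ i, 0 ≤ x i)
    (v : ℝ) :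
    (∑ z ∈ Finset.univ.filter (fun z : Fin Z => v ≤ ∑ i, S z i * x i),
        ⌈α * ((P z).card : ℝ)⌉₊) ≤
      (Finset.univ.filter (fun j : Fin M => v ≤ ∑ i, s i j * x i)).card ∧
    (∀ p : ℝ, 0 ≤ p → p ≤ 1 →
      ⌈p * (Z : ℝ)⌉₊ ≤
        (Finset.univ.filter (fun z : Fin Z => v ≤ ∑ i, S z i * x i)).card →
      ⌈p * (Z : ℝ)⌉₊ *
          (Finset.univ.inf' ⟨⟨0, hZ⟩, Finset.mem_univ _⟩
            (fun z : Fin Z => ⌈α * ((P z).card : ℝ)⌉₊)) ≤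
        (Finset.univ.filter (fun j : Fin M => v ≤ ∑ i, s i j * x i)).card) := by
  have key : (∑ z ∈ Finset.univ.filter (fun z : Fin Z => v ≤ ∑ i, S z i * x i),
        ⌈α * ((P z).card : ℝ)⌉₊) ≤
      (Finset.univ.filter (fun j : Fin M => v ≤ ∑ i, s i j * x i)).card := by
    simp_rw [← hGcard]
    rw [← Finset.card_biUnion fun z₁ _ z₂ _ hne =>
      (hdisj z₁ z₂ hne).mono (hGsub z₁) (hGsub z₂)]
    refine Finset.card_le_card fun j hj => ?_
    obtain ⟨z, hz, hjz⟩ := Finset.mem_biUnion.mp hj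
    refine Finset.mem_filter.mpr ⟨Finset.mem_univ j, (Finset.mem_filter.mp hz).2.trans ?_⟩
    refine Finset.sum_le_sum fun i _ => mul_le_mul_of_nonneg_right ?_ (hx i)
    rw [hS]
    exact Finset.inf'_le _ hjz
  refine ⟨key, fun p _ _ hp => (Nat.mul_le_mul_right _ hp).trans (le_trans ?_ key)⟩
  rw [← smul_eq_mul]
  exact Finset.card_nsmul_le_sum _ _ _ fun z _ => Finset.inf'_le _ (Finset.mem_univ z)
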